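/- Let w ∈ ℝ^n have all entries strictly positive, b ∈ ℝ, σ : ℝ → ℝ continuous satisfying the STFE property, f(x) = σ(wᵀx + b) on [0,1]^n, and let ẑ be the tie point of σ over [b, wᵀ𝟏 + b]. Then for every z ≥ ẑ and every x ∈ [0,1]^n with wᵀx + b ≤ z, conc(f,[0,1]^n)(x) = conc(f, [0,1]^n ∩ {x : wᵀx + b ≤ z})(x). -/

import Mathlib

noncomputable section

/-- `φ` is the concave envelope of `f` over `S`: the pointwise smallest concave
function on `S` that majorizes `f` on `S`. -/
def IsConcaveEnvelope {E : Type*} [AddCommMonoid E] [Module ℝ E]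
    (S : Set E) (f φ : E → ℝ) : Prop :=
  ConcaveOn ℝ S φ ∧ (∀ x ∈ S, f x ≤ φ x) ∧
    ∀ h : E → ℝ, ConcaveOn ℝ S h → (∀ x ∈ S, f x ≤ h x) → ∀ x ∈ S, φ x ≤ h x

/-- `φ` is the convex envelope of `f` over `S`: the pointwise largest convex
function on `S` that minorizes `f` on `S`. -/
def IsConvexEnvelope {E : Type*} [AddCommMonoid E] [Module ℝ E]
    (S : Set E) (f φ : E → ℝ) : Prop :=
  ConvexOn ℝ S φ ∧ (∀ x ∈ S, φ x ≤ f x) ∧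
    ∀ h : E → ℝ, ConvexOn ℝ S h → (∀ x ∈ S, h x ≤ f x) → ∀ x ∈ S, h x ≤ φ x

/-- `zhat ∈ [ℓ,u]` witnesses the secant-then-function form of the concave
envelope of `σ` on `[ℓ,u]`. -/
def STFEwitness (σ : ℝ → ℝ) (ℓ u zhat : ℝ) : Prop :=
  zhat ∈ Set.Icc ℓ u ∧
    IsConcaveEnvelope (Set.Icc ℓ u) σ
      (fun z => if z < zhat then σ ℓ + (σ zhat - σ ℓ) / (zhat - ℓ) * (z - ℓ) else σ z)

/-- The secant-then-function envelope (STFE) property. -/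
def STFE (σ : ℝ → ℝ) : Prop :=
  ∀ ℓ u : ℝ, ℓ ≤ u → ∃ zhat, STFEwitness σ ℓ u zhat

/-- The tie point of `σ` over `[ℓ,u]`: the smallest STFE witness. -/
def IsTiePoint (σ : ℝ → ℝ) (ℓ u zhat : ℝ) : Prop :=
  STFEwitness σ ℓ u zhat ∧ ∀ z, STFEwitness σ ℓ u z → zhat ≤ z

/-- `σ` is S-shaped: convex then concave. -/
def SShaped (σ : ℝ → ℝ) : Prop :=
  ∃ zt : ℝ, ConvexOn ℝ (Set.Iic zt) σ ∧ ConcaveOn ℝ (Set.Ici zt) σ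

/-- The dot product `wᵀx`. -/
def dotp {n : ℕ} (w x : Fin n → ℝ) : ℝ := ∑ i, w i * x i

/-- The region `R_f` of `[0,1]^n`. Note `‖x‖` is the sup norm on `Fin n → ℝ`. -/
def Rf {n : ℕ} (w : Fin n → ℝ) (b zhat : ℝ) : Set (Fin n → ℝ) :=
  {x | x ∈ Set.Icc (0 : Fin n → ℝ) 1 ∧ zhat ≤ dotp w x + b}

/-- The region `R_l` of `[0,1]^n`. -/
def Rl {n : ℕ} (w : Fin n → ℝ) (b zhat : ℝ) : Set (Fin n → ℝ) :=
  {x | x ∈ Set.Icc (0 : Fin n → ℝ) 1 ∧ dotp w x + b < zhat ∧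
    zhat * ‖x‖ ≤ dotp w x + b * ‖x‖}

/-- The region `R_i` of `[0,1]^n`. -/
def Ri {n : ℕ} (w : Fin n → ℝ) (b zhat : ℝ) (i : Fin n) : Set (Fin n → ℝ) :=
  {x | x ∈ Set.Icc (0 : Fin n → ℝ) 1 ∧ dotp w x + b * ‖x‖ < zhat * ‖x‖ ∧
    (∀ j, j < i → x j < x i) ∧ (∀ j, i ≤ j → x j ≤ x i)}

/-- `D'` is a face of the convex set `D`. -/
def IsFace {E : Type*} [AddCommGroup E] [Module ℝ E] (D D' : Set E) : Prop :=
  D' ⊆ D ∧ Convex ℝ D' ∧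
    ∀ x ∈ D, ∀ y ∈ D, ∀ t : ℝ, 0 < t → t < 1 →
      (1 - t) • x + t • y ∈ D' → x ∈ D' ∧ y ∈ D'

/-- Concave functions glue along a hyperplane: if `ψ` is concave on the part of `C` where
`L ≤ c`, lies below the concave function `G` there and agrees with it where `L = c`, then
extending `ψ` by `G` gives a concave function on `C`. -/
theorem ConcaveOn.glue_halfSpace {E : Type*} [AddCommGroup E] [Module ℝ E] {C : Set E}
    (L : E →ₗ[ℝ] ℝ) (c : ℝ) {ψ G : E → ℝ} (hG : ConcaveOn ℝ C G)
    (hψ : ConcaveOn ℝ (C ∩ {x | L x ≤ c}) ψ)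
    (hle : ∀ x ∈ C, L x ≤ c → ψ x ≤ G x) (heq : ∀ x ∈ C, L x = c → ψ x = G x) :
    ConcaveOn ℝ C (fun x => if L x ≤ c then ψ x else G x) := by
  have crossing : ∀ x ∈ C, ∀ y ∈ C, L x ≤ c → c < L y → ∀ a b : ℝ, 0 ≤ a → 0 ≤ b → a + b = 1 →
      L (a • x + b • y) ≤ c → a * ψ x + b * G y ≤ ψ (a • x + b • y) := by
    intro x hx y hy hLx hLy a b ha hb hab hm
    rcases hb.eq_or_lt with rfl | hb'
    · obtain rfl : a = 1 := by linarith
      simp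
    have hd : 0 < L y - L x := by linarith
    obtain ⟨t, ht⟩ : ∃ t, t * (L y - L x) = c - L x :=
      ⟨(c - L x) / (L y - L x), div_mul_cancel₀ _ hd.ne'⟩
    obtain rfl : a = 1 - b := by linarith
    simp only [map_add, map_smul, smul_eq_mul] at hm
    have hbt : b ≤ t := le_of_mul_le_mul_right (by linarith) hd
    have ht1 : t ≤ 1 := le_of_mul_le_mul_right (by linarith) hd
    have ht0 : 0 < t := hb'.trans_le hbt
    have hpC : (1 - t) • x + t • y ∈ C := hG.1 hx hy (by linarith) ht0.le (by ring)
    have hLp : L ((1 - t) • x + t • y) = c := by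
      simp only [map_add, map_smul, smul_eq_mul]
      linarith
    have hGp := hG.2 hx hy (sub_nonneg.2 ht1) ht0.le (by ring)
    have hψm := hψ.2 ⟨hx, hLx⟩ ⟨hpC, hLp.le⟩
      (sub_nonneg.2 ((div_le_one₀ ht0).2 hbt)) (div_nonneg hb ht0.le) (by ring)
    have hbtt : b / t * t = b := div_mul_cancel₀ _ ht0.ne'
    have hm_eq : (1 - b / t) • x + (b / t) • ((1 - t) • x + t • y) = (1 - b) • x + b • y := by
      rw [smul_add, smul_smul, smul_smul, ← add_assoc, ← add_smul, hbtt]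
      congr 2
      linear_combination -hbtt
    rw [hm_eq, heq _ hpC hLp] at hψm
    simp only [smul_eq_mul] at hψm hGp
    have hψGx := hle x hx hLx
    calc (1 - b) * ψ x + b * G y
        = (1 - b / t) * ψ x + b / t * ((1 - t) * ψ x + t * G y) := by
          linear_combination (ψ x - G y) * hbtt
      _ ≤ (1 - b / t) * ψ x + b / t * G ((1 - t) • x + t • y) := by
          have := mul_le_mul_of_nonneg_left hψGx (sub_nonneg.2 ht1)
          gcongr
          linarith
      _ ≤ _ := hψm
  have hleG : ∀ x ∈ C, (if L x ≤ c then ψ x else G x) ≤ G x := by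
    intro x hx
    split_ifs with h
    exacts [hle x hx h, le_rfl]
  refine ⟨hG.1, fun x hx y hy a b ha hb hab => ?_⟩
  by_cases hm : L (a • x + b • y) ≤ c
  · by_cases hLx : L x ≤ c <;> by_cases hLy : L y ≤ c
    · simpa only [hLx, hLy, hm, if_true, smul_eq_mul] using hψ.2 ⟨hx, hLx⟩ ⟨hy, hLy⟩ ha hb hab
    · simpa only [hLx, hLy, hm, if_true, if_false, smul_eq_mul] using
        crossing x hx y hy hLx (not_le.1 hLy) a b ha hb hab hm
    · rw [add_comm (a • x)] at hm ⊢
      rw [add_comm (a • _)]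
      simpa only [hLx, hLy, hm, if_true, if_false, smul_eq_mul] using
        crossing y hy x hx hLy (not_le.1 hLx) b a hb ha (by linarith) hm
    · rw [map_add, map_smul, map_smul] at hm
      exact absurd hm (not_le.2 (convex_Ioi c (not_le.1 hLx) (not_le.1 hLy) ha hb hab))
  · simp only [hm, if_false]
    refine le_trans ?_ (hG.2 hx hy ha hb hab)
    simp only [smul_eq_mul]
    gcongr
    exacts [hleG x hx, hleG y hy]

/-- The functional `x ↦ wᵀx` as a linear map. -/
def dotpLinear {n : ℕ} (w : Fin n → ℝ) : (Fin n → ℝ) →ₗ[ℝ] ℝ where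
  toFun := dotp w
  map_add' x y := by simp [dotp, mul_add, Finset.sum_add_distrib]
  map_smul' r x := by
    simp only [dotp, Pi.smul_apply, smul_eq_mul, RingHom.id_apply, Finset.mul_sum]
    exact Finset.sum_congr rfl fun i _ => by ring

theorem dotp_mem_Icc {n : ℕ} {w : Fin n → ℝ} (hw : ∀ i, 0 ≤ w i) {x : Fin n → ℝ}
    (hx : x ∈ Set.Icc 0 1) : dotp w x ∈ Set.Icc 0 (∑ i, w i) :=
  ⟨Finset.sum_nonneg fun i _ => mul_nonneg (hw i) (hx.1 i),
    Finset.sum_le_sum fun i _ => mul_le_of_le_one_right (hw i) (hx.2 i)⟩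

/-- Composing a concave function on `[b, ∑ wᵢ + b]` with `x ↦ wᵀx + b` gives a concave function
on the unit cube. -/
theorem ConcaveOn.comp_dotp_add {n : ℕ} {w : Fin n → ℝ} (hw : ∀ i, 0 ≤ w i) {b : ℝ} {τ : ℝ → ℝ}
    (hτ : ConcaveOn ℝ (Set.Icc b ((∑ i, w i) + b)) τ) :
    ConcaveOn ℝ (Set.Icc (0 : Fin n → ℝ) 1) (fun x => τ (dotp w x + b)) := by
  have hmem : ∀ x ∈ Set.Icc (0 : Fin n → ℝ) 1,
      dotp w x + b ∈ Set.Icc b ((∑ i, w i) + b) := fun x hx =>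
    ⟨by linarith [(dotp_mem_Icc hw hx).1], by linarith [(dotp_mem_Icc hw hx).2]⟩
  refine ⟨convex_Icc _ _, fun x hx y hy s t hs ht hst => ?_⟩
  convert hτ.2 (hmem x hx) (hmem y hy) hs ht hst using 2
  have h : dotp w (s • x + t • y) = s * dotp w x + t * dotp w y :=
    ((dotpLinear w).map_add _ _).trans
      (congrArg₂ (· + ·) ((dotpLinear w).map_smul s x) ((dotpLinear w).map_smul t y))
  simp only [h, smul_eq_mul]
  linear_combination -b * hst


theorem stmt8 {n : ℕ} (w : Fin n → ℝ) (hw : ∀ i, 0 < w i) (b : ℝ)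
    (σ : ℝ → ℝ) (hσ : Continuous σ) (hSTFE : STFE σ)
    (zhat : ℝ) (htie : IsTiePoint σ b ((∑ i, w i) + b) zhat)
    (z : ℝ) (hz : zhat ≤ z)
    (φ ψ : (Fin n → ℝ) → ℝ)
    (hφ : IsConcaveEnvelope (Set.Icc 0 1) (fun x => σ (dotp w x + b)) φ)
    (hψ : IsConcaveEnvelope (Set.Icc 0 1 ∩ {x | dotp w x + b ≤ z})
      (fun x => σ (dotp w x + b)) ψ) :
    ∀ x ∈ Set.Icc (0 : Fin n → ℝ) 1, dotp w x + b ≤ z → φ x = ψ x := by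
  obtain ⟨⟨-, hτ, hστ, -⟩, -⟩ := htie
  set τ : ℝ → ℝ := fun s =>
    if s < zhat then σ b + (σ zhat - σ b) / (zhat - b) * (s - b) else σ s with hτ_def
  have hw' : ∀ i, 0 ≤ w i := fun i => (hw i).le
  have hG := hτ.comp_dotp_add hw'
  have hfG : ∀ x ∈ Set.Icc (0 : Fin n → ℝ) 1, σ (dotp w x + b) ≤ τ (dotp w x + b) := fun x hx =>
    hστ _ ⟨by linarith [(dotp_mem_Icc hw' hx).1], by linarith [(dotp_mem_Icc hw' hx).2]⟩
  have hψG : ∀ x ∈ Set.Icc (0 : Fin n → ℝ) 1, dotp w x + b ≤ z → ψ x ≤ τ (dotp w x + b) :=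
    fun x hx hxz => hψ.2.2 _ (hG.subset Set.inter_subset_left hψ.1.1)
      (fun y hy => hfG y hy.1) x ⟨hx, hxz⟩
  have hset : Set.Icc (0 : Fin n → ℝ) 1 ∩ {x | dotp w x + b ≤ z} =
      Set.Icc 0 1 ∩ {x | dotpLinear w x ≤ z - b} := by
    simp only [le_sub_iff_add_le]
    rfl
  have hglue := hG.glue_halfSpace (dotpLinear w) (z - b) (hset ▸ hψ.1)
    (fun x hx hxz => hψG x hx (le_sub_iff_add_le.1 hxz)) (fun x hx hxz => by
      have hxz' : dotp w x + b = z := eq_sub_iff_add_eq.1 hxz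
      refine (hψG x hx hxz'.le).antisymm ?_
      have hfψ := hψ.2.1 x ⟨hx, hxz'.le⟩
      simpa only [hτ_def, hxz', not_lt.2 hz, if_false] using hfψ)
  intro x hx hxz
  refine le_antisymm ?_ (hψ.2.2 φ (hφ.1.subset Set.inter_subset_left hψ.1.1)
    (fun y hy => hφ.2.1 y hy.1) x ⟨hx, hxz⟩)
  refine (hφ.2.2 _ hglue (fun y hy => ?_) x hx).trans_eq (if_pos (le_sub_iff_add_le.2 hxz))
  split_ifs with hyz
  exacts [hψ.2.1 y ⟨hy, le_sub_iff_add_le.1 hyz⟩, hfG y hy]
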